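/- Let q ≥ 1, α ∈ ℝ, n ∈ ℕ₀, and (s_j)_{j=0}^{2n+1} ∈ K≥,e_{α,q,2n+1}; write T := T_{q,n}, v := v_{q,n} and I := I_{(n+1)q}. Then H_n^⊐·R_T(α)·( v·v*·H_n·H_{α▷n}^⊐ + T ) = H_{α▷n}^⊐, and H_{α▷n}^⊐·( I − H_n·v·v*·R_{T*}(α)·H_n^⊐ ) = T*·R_{T*}(α)·H_n^⊐. -/

import Mathlib

open Matrix ComplexConjugate
open scoped ComplexOrder

noncomputable section

/-- The block Hankel matrix `H_n = [s_{j+k}]_{j,k=0}^n`. -/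
def hank (q n : ℕ) (s : ℕ → Matrix (Fin q) (Fin q) ℂ) :
    Matrix (Fin (n + 1) × Fin q) (Fin (n + 1) × Fin q) ℂ :=
  Matrix.of fun j k => s (j.1.val + k.1.val) j.2 k.2

/-- The right-sided `α`-shifted sequence `s_{α▷j} = -α·s_j + s_{j+1}`. -/
def sShift {q : ℕ} (α : ℝ) (s : ℕ → Matrix (Fin q) (Fin q) ℂ) :
    ℕ → Matrix (Fin q) (Fin q) ℂ :=
  fun j => (-(α : ℂ)) • s j + s (j + 1)

/-- The block shift `T_{q,n} = [δ_{j,k+1}·I_q]_{j,k=0}^n`. -/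
def bshift (q n : ℕ) : Matrix (Fin (n + 1) × Fin q) (Fin (n + 1) × Fin q) ℂ :=
  Matrix.of fun j k => if j.1.val = k.1.val + 1 ∧ j.2 = k.2 then (1 : ℂ) else 0

/-- `v_{q,n} = col(δ_{j,0}·I_q)_{j=0}^n`. -/
def vq (q n : ℕ) : Matrix (Fin (n + 1) × Fin q) (Fin q) ℂ :=
  Matrix.of fun j b => if j.1.val = 0 ∧ j.2 = b then (1 : ℂ) else 0

/-- `u_n = -col(s_{j-1})_{j=0}^n` with `s_{-1} = 0`. -/
def uq (q n : ℕ) (s : ℕ → Matrix (Fin q) (Fin q) ℂ) :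
    Matrix (Fin (n + 1) × Fin q) (Fin q) ℂ :=
  Matrix.of fun j b => if j.1.val = 0 then 0 else -s (j.1.val - 1) j.2 b

/-- `y_{0,n} = col(s_j)_{j=0}^n`. -/
def yq (q n : ℕ) (s : ℕ → Matrix (Fin q) (Fin q) ℂ) :
    Matrix (Fin (n + 1) × Fin q) (Fin q) ℂ :=
  Matrix.of fun j b => s j.1.val j.2 b

/-- `R_T(z) = (I - z·T_{q,n})⁻¹`. -/
def RT (q n : ℕ) (z : ℂ) : Matrix (Fin (n + 1) × Fin q) (Fin (n + 1) × Fin q) ℂ :=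
  (1 - z • bshift q n)⁻¹

/-- `R_{T*}(z) = (I - z·T_{q,n}*)⁻¹`. -/
def RTs (q n : ℕ) (z : ℂ) : Matrix (Fin (n + 1) × Fin q) (Fin (n + 1) × Fin q) ℂ :=
  (1 - z • (bshift q n)ᴴ)⁻¹

open scoped Classical in
/-- The Moore–Penrose inverse of a complex matrix (it exists and is unique,
so the `dite` below always takes its first branch and picks it out). -/
def mp {m n : Type*} [Fintype m] [Fintype n] (A : Matrix m n ℂ) : Matrix n m ℂ :=
  if h : ∃ X : Matrix n m ℂ,
      A * X * A = A ∧ X * A * X = X ∧ (A * X)ᴴ = A * X ∧ (X * A)ᴴ = X * A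
  then h.choose else 0

/-- The Schur complements `L_0 = s_0` and
`L_j = s_{2j} - z_{j,2j-1}·(H_{j-1})^†·y_{j,2j-1}` for `j ≥ 1`. -/
def LS (q : ℕ) (s : ℕ → Matrix (Fin q) (Fin q) ℂ) : ℕ → Matrix (Fin q) (Fin q) ℂ
  | 0 => s 0
  | n + 1 =>
      s (2 * (n + 1)) -
        (Matrix.of fun (a : Fin q) (j : Fin (n + 1) × Fin q) => s ((n + 1) + j.1.val) a j.2) *
          mp (hank q n s) *
          (Matrix.of fun (j : Fin (n + 1) × Fin q) (b : Fin q) => s ((n + 1) + j.1.val) j.2 b)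

/-- The block diagonal matrix `diag(L_0, …, L_n)`. -/
def Ldiag (q n : ℕ) (s : ℕ → Matrix (Fin q) (Fin q) ℂ) :
    Matrix (Fin (n + 1) × Fin q) (Fin (n + 1) × Fin q) ℂ :=
  Matrix.of fun j k => if j.1 = k.1 then LS q s j.1.val j.2 k.2 else 0

/-- The subspace `D_n = range(diag(L_0, …, L_n)) ⊆ ℂ^{(n+1)q}`. -/
def Dsub (q n : ℕ) (s : ℕ → Matrix (Fin q) (Fin q) ℂ) :
    Submodule ℂ (Fin (n + 1) × Fin q → ℂ) :=
  LinearMap.range (Matrix.mulVecLin (Ldiag q n s))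

/-- `V_{q,n+1} = [δ_{j,k}·I_q]`, embedding `ℂ^{(n+1)q}` into the first `n+1` block
components of `ℂ^{(n+2)q}` (defined here with `n+1` block columns). -/
def embV (q n : ℕ) : Matrix (Fin (n + 1) × Fin q) (Fin n × Fin q) ℂ :=
  Matrix.of fun j k => if j.1.val = k.1.val ∧ j.2 = k.2 then (1 : ℂ) else 0

/-- `𝔙_{q,n+1} = [δ_{j,k+1}·I_q]`, embedding `ℂ^{(n+1)q}` into the last `n+1` block
components of `ℂ^{(n+2)q}` (defined here with `n+1` block columns). -/
def embW (q n : ℕ) : Matrix (Fin (n + 1) × Fin q) (Fin n × Fin q) ℂ :=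
  Matrix.of fun j k => if j.1.val = k.1.val + 1 ∧ j.2 = k.2 then (1 : ℂ) else 0

end

/-- `G` is the generalized inverse `H_D^⊐` of a Hermitian matrix `H` associated with a
subspace `D`: `HGH = H`, `GHG = G`, `range G = D` and `ker G = D^⊥`. -/
def IsRGI {ι : Type*} [Fintype ι] (H G : Matrix ι ι ℂ) (D : Submodule ℂ (ι → ℂ)) : Prop :=
  H * G * H = H ∧ G * H * G = G ∧
    LinearMap.range (Matrix.mulVecLin G) = D ∧
    ∀ x : ι → ℂ, Matrix.mulVec G x = 0 ↔ ∀ y ∈ D, dotProduct (star y) x = 0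


def KerP {q : ℕ} (t : ℕ → Matrix (Fin q) (Fin q) ℂ) (m j : ℕ) (p : ℕ → Fin q → ℂ) : Prop :=
  ∀ i ≤ m, ∑ k ∈ Finset.range (j + 1), t (i + k) *ᵥ p k = 0

lemma hank_mulVec_apply (q n : ℕ) (t : ℕ → Matrix (Fin q) (Fin q) ℂ) (p : ℕ → Fin q → ℂ)
    (i : Fin (n + 1)) (a : Fin q) :
    (hank q n t *ᵥ (fun k => p k.1.val k.2)) (i, a)
      = (∑ k ∈ Finset.range (n + 1), t (i.val + k) *ᵥ p k) a := by
  rw [Finset.sum_range, Finset.sum_apply]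
  simp only [mulVec, dotProduct, hank, Matrix.of_apply, Fintype.sum_prod_type]

lemma kerP_iff (q n : ℕ) (t : ℕ → Matrix (Fin q) (Fin q) ℂ) (p : ℕ → Fin q → ℂ) :
    KerP t n n p ↔ hank q n t *ᵥ (fun k => p k.1.val k.2) = 0 := by
  constructor
  · intro h
    ext ⟨i, a⟩
    rw [hank_mulVec_apply, h i (by omega)]; rfl
  · intro h i hi
    ext a
    have := congrFun h (⟨i, by omega⟩, a)
    rw [hank_mulVec_apply] at this
    exact this

lemma hank_psd_mono {q m n : ℕ} (hmn : m ≤ n) {t : ℕ → Matrix (Fin q) (Fin q) ℂ}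
    (h : (hank q n t).PosSemidef) : (hank q m t).PosSemidef := by
  have := h.submatrix (fun x : Fin (m + 1) × Fin q => (Fin.castLE (by omega : m + 1 ≤ n + 1) x.1, x.2))
  exact this

lemma kerP_ext {q j : ℕ} {t : ℕ → Matrix (Fin q) (Fin q) ℂ}
    (h : (hank q (j + 1) t).PosSemidef) {p : ℕ → Fin q → ℂ} (hp : KerP t j j p) :
    KerP t (j + 1) j p := by
  let p' : ℕ → Fin q → ℂ := fun k => if k ≤ j then p k else 0
  have hs : ∀ i, ∑ k ∈ Finset.range (j + 1 + 1), t (i + k) *ᵥ p' k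
      = ∑ k ∈ Finset.range (j + 1), t (i + k) *ᵥ p k := by
    intro i
    rw [Finset.sum_range_succ]
    have : p' (j + 1) = 0 := by simp [p']
    rw [this, mulVec_zero, add_zero]
    apply Finset.sum_congr rfl
    intro k hk
    have : k ≤ j := by simp at hk; omega
    simp [p', this]
  have key : KerP t (j + 1) (j + 1) p' := by
    rw [kerP_iff, ← h.dotProduct_mulVec_zero_iff]
    apply Finset.sum_eq_zero
    rintro ⟨i, a⟩ -
    by_cases hi : i.val ≤ j
    · rw [hank_mulVec_apply, hs, hp _ hi]; simp
    · simp [p', hi]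
  intro i hi
  rw [← hs]; exact key i hi

lemma sum_shift {q : ℕ} (α : ℝ) (t : ℕ → Matrix (Fin q) (Fin q) ℂ) (p : ℕ → Fin q → ℂ) (i N : ℕ) :
    ∑ k ∈ Finset.range N, sShift α t (i + k) *ᵥ p k
     = (-(α : ℂ)) • ∑ k ∈ Finset.range N, t (i + k) *ᵥ p k
       + ∑ k ∈ Finset.range N, t (i + 1 + k) *ᵥ p k := by
  rw [Finset.smul_sum, ← Finset.sum_add_distrib]
  apply Finset.sum_congr rfl
  intro k _
  rw [sShift, add_mulVec, smul_mulVec, show i + 1 + k = i + k + 1 by omega]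

lemma step1 {q j : ℕ} (α : ℝ) {t : ℕ → Matrix (Fin q) (Fin q) ℂ}
    (h : (hank q (j + 1) t).PosSemidef) {p : ℕ → Fin q → ℂ} (hp : KerP t j j p) :
    KerP (sShift α t) j j p := by
  have := kerP_ext h hp
  intro i hi
  rw [sum_shift, hp i hi, this (i + 1) (by omega)]; simp

lemma step2 {q j : ℕ} (α : ℝ) {t : ℕ → Matrix (Fin q) (Fin q) ℂ}
    (h : (hank q (j + 1) (sShift α t)).PosSemidef) {p : ℕ → Fin q → ℂ}
    (hp : KerP (sShift α t) j j p) :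
    ∃ p', p' (j + 1) = p j ∧ KerP t (j + 1) (j + 1) p' := by
  have hx := kerP_ext h hp
  refine ⟨fun k => (if k = 0 then 0 else p (k - 1)) + (-(α : ℂ)) • (if k ≤ j then p k else 0), by simp, ?_⟩
  intro i hi
  have := hx i hi
  rw [sum_shift] at this
  simp only [mulVec_add, mulVec_smul, Finset.sum_add_distrib]
  rw [Finset.sum_range_succ', ← Finset.smul_sum, Finset.sum_range_succ (n := j + 1)]
  simp only [Nat.add_sub_cancel, Nat.add_eq_zero_iff, one_ne_zero, and_false, if_false, if_true,
    mulVec_zero, add_zero, show ¬ (j + 1 ≤ j) by omega]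
  rw [add_comm, ← this]
  congr 2
  · apply Finset.sum_congr rfl
    intro k hk
    have : k ≤ j := by simp at hk; omega
    simp [this]
  · ext k
    rw [show i + 1 + k = i + (k + 1) by omega]

lemma mp_spec {m : Type*} [Fintype m] [DecidableEq m] {A : Matrix m m ℂ} (hA : A.IsHermitian) :
    A * mp A * A = A := by
  have h : ∃ X : Matrix m m ℂ,
      A * X * A = A ∧ X * A * X = X ∧ (A * X)ᴴ = A * X ∧ (X * A)ᴴ = X * A := by
    set U : Matrix m m ℂ := (hA.eigenvectorUnitary : Matrix m m ℂ) with hU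
    set d : m → ℂ := fun i => (hA.eigenvalues i : ℂ)
    have hUU : Uᴴ * U = 1 := by
      have := Unitary.coe_star_mul_self hA.eigenvectorUnitary
      simpa [star_eq_conjTranspose] using this
    have hs : A = U * diagonal d * Uᴴ := by
      have := hA.spectral_theorem
      simp only [Unitary.conjStarAlgAut_apply, star_eq_conjTranspose] at this
      exact this
    have hm : ∀ X Y : Matrix m m ℂ, (U * X * Uᴴ) * (U * Y * Uᴴ) = U * (X * Y) * Uᴴ := by
      intro X Y
      calc _ = U * X * (Uᴴ * U) * Y * Uᴴ := by simp only [Matrix.mul_assoc]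
        _ = _ := by rw [hUU]; simp only [Matrix.mul_assoc, Matrix.mul_one]
    have hc : ∀ X : Matrix m m ℂ, (U * X * Uᴴ)ᴴ = U * Xᴴ * Uᴴ := by
      intro X; simp [Matrix.mul_assoc]
    refine ⟨U * diagonal (fun i => (d i)⁻¹) * Uᴴ, ?_⟩
    rw [hs]
    simp only [hm, hc, diagonal_mul_diagonal, diagonal_conjTranspose]
    refine ⟨?_, ?_, ?_, ?_⟩ <;> congr 3 <;> ext i <;>
      by_cases h0 : d i = 0 <;> simp [h0]
  unfold mp
  rw [dif_pos h]
  exact h.choose_spec.1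

lemma schur_ker {m k : Type*} [Fintype m] [DecidableEq m] [Fintype k] [DecidableEq k]
    {A X : Matrix m m ℂ} {B : Matrix m k ℂ} {D : Matrix k k ℂ}
    (h : (fromBlocks A B Bᴴ D).PosSemidef) (hX : A * X * A = A) (x : k → ℂ) :
    (D - Bᴴ * X * B) *ᵥ x = 0 ↔ ∃ u, A *ᵥ u + B *ᵥ x = 0 ∧ Bᴴ *ᵥ u + D *ᵥ x = 0 := by
  have hA : Aᴴ = A := by
    have := h.1
    rw [isHermitian_fromBlocks_iff] at this
    exact this.1
  have hk : ∀ u, A *ᵥ u = 0 → Bᴴ *ᵥ u = 0 := by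
    intro u hu
    have h1 : fromBlocks A B Bᴴ D *ᵥ Sum.elim u 0 = 0 := by
      rw [← h.dotProduct_mulVec_zero_iff]
      rw [fromBlocks_mulVec]
      simp [dotProduct, Fintype.sum_sum_type, hu]
    rw [fromBlocks_mulVec] at h1
    ext i
    have := congrFun h1 (Sum.inr i)
    simpa using this
  have hz : ∀ Y : Matrix m m ℂ, A * Y * A = A → Bᴴ * Y * A = Bᴴ := by
    intro Y hY
    apply Matrix.ext_of_mulVec_single
    intro i
    have := hk (Pi.single i 1 - Y *ᵥ (A *ᵥ Pi.single i 1)) (by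
      rw [mulVec_sub, mulVec_mulVec, mulVec_mulVec, hY, sub_self])
    rw [mulVec_sub, mulVec_mulVec, mulVec_mulVec, sub_eq_zero] at this
    exact this.symm
  have hy : A * X * B = B := by
    have := congrArg conjTranspose (hz Xᴴ (by
      have := congrArg conjTranspose hX
      simpa [hA, Matrix.mul_assoc] using this))
    simpa [hA, Matrix.mul_assoc] using this
  have hzX := hz X hX
  constructor
  · intro hx
    refine ⟨-((X * B) *ᵥ x), ?_, ?_⟩
    · rw [mulVec_neg, mulVec_mulVec, ← Matrix.mul_assoc, hy]; simp
    · rw [sub_mulVec] at hx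
      rw [mulVec_neg, mulVec_mulVec, ← Matrix.mul_assoc, ← hx]; abel
  · rintro ⟨u, h1, h2⟩
    have h3 : Bᴴ *ᵥ u + (Bᴴ * X * B) *ᵥ x = 0 := by
      have := congrArg (fun w => (Bᴴ * X) *ᵥ w) h1
      simp only [mulVec_add, mulVec_mulVec, mulVec_zero, hzX] at this
      exact this
    rw [sub_mulVec, ← h2, eq_comm, ← sub_eq_zero, ← h3]; abel


lemma hank_herm {q n : ℕ} {t : ℕ → Matrix (Fin q) (Fin q) ℂ} (h : (hank q n t).PosSemidef)
    {i : ℕ} (hi : i ≤ 2 * n) : (t i)ᴴ = t i := by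
  obtain ⟨a, b, ha, hb, rfl⟩ : ∃ a b, a ≤ n ∧ b ≤ n ∧ i = a + b :=
    ⟨min i n, i - min i n, by omega, by omega, by omega⟩
  ext x y
  have := congrFun (congrFun h.1 ((⟨a, by omega⟩ : Fin (n + 1)), x)) ((⟨b, by omega⟩ : Fin (n + 1)), y)
  simp only [conjTranspose_apply, hank, of_apply] at this
  rw [conjTranspose_apply, ← this, add_comm]

lemma LS_ker {q j : ℕ} {t : ℕ → Matrix (Fin q) (Fin q) ℂ} (h : (hank q j t).PosSemidef)
    (x : Fin q → ℂ) :
    (LS q t j)ᴴ *ᵥ x = 0 ↔ ∃ p : ℕ → Fin q → ℂ, p j = x ∧ KerP t j j p := by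
  cases j with
  | zero =>
    rw [LS, hank_herm h (by omega)]
    constructor
    · intro hx
      refine ⟨fun _ => x, rfl, ?_⟩
      intro i hi
      obtain rfl : i = 0 := by omega
      simpa using hx
    · rintro ⟨p, rfl, hp⟩
      simpa using hp 0 le_rfl
  | succ j =>
    have hj := hank_psd_mono (Nat.le_succ j) h
    set B : Matrix (Fin (j + 1) × Fin q) (Fin q) ℂ :=
      Matrix.of fun (k : Fin (j + 1) × Fin q) (b : Fin q) => t ((j + 1) + k.1.val) k.2 b with hB
    have hz : (Matrix.of fun (a : Fin q) (k : Fin (j + 1) × Fin q) => t ((j + 1) + k.1.val) a k.2)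
        = Bᴴ := by
      ext a k
      have := hank_herm h (i := j + 1 + k.1.val) (by omega)
      rw [conjTranspose_apply, hB, of_apply, of_apply, ← conjTranspose_apply, this]
    have hL : (LS q t (j + 1))ᴴ = t (2 * (j + 1)) - Bᴴ * (mp (hank q j t))ᴴ * B := by
      rw [LS, hz, conjTranspose_sub, hank_herm h (by omega)]
      simp [Matrix.mul_assoc, hB]
    have hX : hank q j t * (mp (hank q j t))ᴴ * hank q j t = hank q j t := by
      have := congrArg conjTranspose (mp_spec hj.1)
      have e : (hank q j t)ᴴ = hank q j t := hj.1
      simpa [e, Matrix.mul_assoc] using this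
    have hbl : (fromBlocks (hank q j t) B Bᴴ (t (2 * (j + 1)))).PosSemidef := by
      have := h.submatrix (Sum.elim (fun k : Fin (j + 1) × Fin q => (k.1.castSucc, k.2))
        (fun a : Fin q => (Fin.last (j + 1), a)))
      convert this using 1
      rw [← hz]
      ext (a | a) (b | b)
      · simp [hank]
      · simp [hank, hB, add_comm]
      · simp [hank]
      · simp [hank, two_mul]
    rw [hL, schur_ker hbl hX]
    have hBu : ∀ (p : ℕ → Fin q → ℂ), Bᴴ *ᵥ (fun k => p k.1.val k.2)
        = ∑ k ∈ Finset.range (j + 1), t (j + 1 + k) *ᵥ p k := by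
      intro p
      ext a
      rw [← hz, Finset.sum_range, Finset.sum_apply]
      simp only [mulVec, dotProduct, Matrix.of_apply, Fintype.sum_prod_type]
    have hBx : ∀ (i : Fin (j + 1)) (a : Fin q), (B *ᵥ x) (i, a) = (t (i.val + (j + 1)) *ᵥ x) a := by
      intro i a
      simp only [mulVec, dotProduct, hB, Matrix.of_apply]
      rw [add_comm]
    constructor
    · rintro ⟨u, h1, h2⟩
      let p : ℕ → Fin q → ℂ := fun k => if hk : k < j + 1 then fun a => u (⟨k, hk⟩, a) else x
      have hp : p (j + 1) = x := by simp [p]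
      have hu : u = fun k => p k.1.val k.2 := by
        ext ⟨k, a⟩; simp only [p]; rw [dif_pos k.isLt]
      rw [hu] at h1 h2
      refine ⟨p, hp, ?_⟩
      intro i hi
      rw [Finset.sum_range_succ, hp]
      rcases Nat.lt_or_ge i (j + 1) with hij | hij
      · ext a
        have := congrFun h1 (⟨i, hij⟩, a)
        rw [Pi.add_apply, hank_mulVec_apply, hBx] at this
        exact this
      · obtain rfl : i = j + 1 := by omega
        rw [hBu, two_mul] at h2
        exact h2
    · rintro ⟨p, hp, hK⟩
      refine ⟨fun k => p k.1.val k.2, ?_, ?_⟩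
      · ext ⟨i, a⟩
        rw [Pi.add_apply, hank_mulVec_apply, hBx]
        have := hK i.val (by omega)
        rw [Finset.sum_range_succ, hp] at this
        exact congrFun this a
      · have := hK (j + 1) le_rfl
        rw [Finset.sum_range_succ, hp] at this
        rw [hBu, two_mul]; exact this

lemma hank_congr {q n : ℕ} {s t : ℕ → Matrix (Fin q) (Fin q) ℂ} (h : ∀ i ≤ 2 * n, t i = s i) :
    hank q n t = hank q n s := by
  ext j k
  simp only [hank, of_apply]
  rw [h _ (by omega)]

lemma LS_congr {q j : ℕ} {s t : ℕ → Matrix (Fin q) (Fin q) ℂ} (h : ∀ i ≤ 2 * j, t i = s i) :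
    LS q t j = LS q s j := by
  cases j with
  | zero => exact h 0 (by omega)
  | succ j =>
    have e : ∀ k : Fin (j + 1), t (j + 1 + k.val) = s (j + 1 + k.val) := fun k => h _ (by omega)
    simp only [LS, e]
    rw [h _ le_rfl, hank_congr (fun i hi => h i (by omega))]

lemma ldiag_ker (q n : ℕ) (s : ℕ → Matrix (Fin q) (Fin q) ℂ) (x : Fin (n + 1) × Fin q → ℂ) :
    (∀ y ∈ Dsub q n s, star y ⬝ᵥ x = 0) ↔
      ∀ j : Fin (n + 1), (LS q s j.val)ᴴ *ᵥ (fun a => x (j, a)) = 0 := by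
  have h1 : (∀ y ∈ Dsub q n s, star y ⬝ᵥ x = 0) ↔ (Ldiag q n s)ᴴ *ᵥ x = 0 := by
    have e : ∀ w, star (Ldiag q n s *ᵥ w) ⬝ᵥ x = star w ⬝ᵥ ((Ldiag q n s)ᴴ *ᵥ x) := by
      intro w; rw [star_mulVec, dotProduct_mulVec]
    constructor
    · intro h
      rw [← dotProduct_star_self_eq_zero, ← e]
      exact h _ ⟨_, rfl⟩
    · rintro h _ ⟨w, rfl⟩
      rw [mulVecLin_apply, e, h, dotProduct_zero]
  have h2 : ∀ j a, ((Ldiag q n s)ᴴ *ᵥ x) (j, a) = ((LS q s j.val)ᴴ *ᵥ (fun a => x (j, a))) a := by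
    intro j a
    simp only [mulVec, dotProduct, conjTranspose_apply, Ldiag, of_apply, Fintype.sum_prod_type]
    rw [Finset.sum_eq_single j]
    · simp
    · intro b _ hb; simp [hb]
    · simp
  rw [h1]
  constructor
  · intro h j; ext a; rw [← h2, h]; rfl
  · intro h; ext ⟨j, a⟩; rw [h2, h]; rfl

lemma rgi_herm {ι : Type*} [Fintype ι] [DecidableEq ι] {H G : Matrix ι ι ℂ}
    {D : Submodule ℂ (ι → ℂ)} (hH : Hᴴ = H) (h : IsRGI H G D) : Gᴴ = G := by
  obtain ⟨_, h2, h3, h4⟩ := h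
  have key : G * (H * Gᴴ) = G := by
    apply Matrix.ext_of_mulVec_single
    intro i
    have : G *ᵥ ((1 - H * Gᴴ) *ᵥ Pi.single i 1) = 0 := by
      rw [h4]
      rw [← h3]
      rintro _ ⟨w, rfl⟩
      rw [mulVecLin_apply, star_mulVec, ← dotProduct_mulVec, mulVec_mulVec]
      have : Gᴴ * (1 - H * Gᴴ) = 0 := by
        have := congrArg conjTranspose h2
        simp only [conjTranspose_mul, hH] at this
        rw [Matrix.mul_sub, this]; simp
      rw [this, zero_mulVec, dotProduct_zero]
    rw [sub_mulVec, one_mulVec, mulVec_sub, mulVec_mulVec, sub_eq_zero] at this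
    exact this.symm
  rw [← key]
  simp [hH, Matrix.mul_assoc]

lemma bshift_zero (q n : ℕ) (x : Fin (n + 1) × Fin q → ℂ) (a : Fin q) :
    (bshift q n *ᵥ x) (0, a) = 0 := by
  simp [mulVec, dotProduct, bshift]

lemma bshift_succ (q n : ℕ) (x : Fin (n + 1) × Fin q → ℂ) (i : Fin n) (a : Fin q) :
    (bshift q n *ᵥ x) (i.succ, a) = x (i.castSucc, a) := by
  simp only [mulVec, dotProduct, bshift, of_apply]
  rw [Finset.sum_eq_single (i.castSucc, a)]
  · simp
  · rintro ⟨b, c⟩ _ hb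
    rw [if_neg, zero_mul]
    rintro ⟨h1, h2⟩
    apply hb
    simp only [Fin.val_succ] at h1 h2
    ext <;> simp [← h2]
    omega
  · simp

lemma vv_apply (q n : ℕ) (x : Fin (n + 1) × Fin q → ℂ) (i : Fin (n + 1)) (a : Fin q) :
    ((vq q n * (vq q n)ᴴ) *ᵥ x) (i, a) = if i = 0 then x (i, a) else 0 := by
  have e : vq q n * (vq q n)ᴴ = diagonal (fun k : Fin (n + 1) × Fin q => if k.1 = 0 then (1 : ℂ) else 0) := by
    ext ⟨j, b⟩ ⟨k, c⟩
    simp only [mul_apply, vq, of_apply, conjTranspose_apply, diagonal_apply, Prod.mk.injEq]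
    rw [Finset.sum_eq_single b]
    · by_cases hj : j = 0
      · subst hj
        by_cases hk : k = 0
        · subst hk
          by_cases hbc : b = c
          · subst hbc; simp
          · simp [hbc, Ne.symm hbc]
        · have : k.val ≠ 0 := fun h => hk (Fin.ext h)
          simp [this, Ne.symm hk, hk]
      · have : j.val ≠ 0 := fun h => hj (Fin.ext h)
        simp [this, hj]
    · intro x _ hx
      rw [if_neg (fun h => hx h.2.symm), zero_mul]
    · simp
  rw [e, mulVec_diagonal]
  by_cases hi : i = 0 <;> simp [hi]

lemma shift_unit (q n : ℕ) (z : ℂ) : IsUnit (1 - z • bshift q n) := by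
  rw [← mulVec_injective_iff_isUnit]
  apply (injective_iff_map_eq_zero (mulVecLin (1 - z • bshift q n))).2
  intro x hx
  rw [mulVecLin_apply, sub_mulVec, one_mulVec, smul_mulVec] at hx
  have key : ∀ i : Fin (n + 1), ∀ a, x (i, a) = 0 := by
    intro i
    induction i using Fin.induction with
    | zero =>
      intro a
      have := congrFun hx (0, a)
      simpa [bshift_zero] using this
    | succ i ih =>
      intro a
      have := congrFun hx (i.succ, a)
      simpa [bshift_succ, ih] using this
  ext ⟨i, a⟩; exact key i a

lemma link (q n : ℕ) (α : ℝ) (s : ℕ → Matrix (Fin q) (Fin q) ℂ) :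
    bshift q n * hank q n (sShift α s) =
      (1 - (α : ℂ) • bshift q n) * hank q n s - vq q n * (vq q n)ᴴ * hank q n s := by
  have col : ∀ (A B : Matrix (Fin (n + 1) × Fin q) (Fin (n + 1) × Fin q) ℂ) i k,
      (A * B) i k = (A *ᵥ (fun j => B j k)) i := by intro A B i k; rfl
  ext ⟨i, a⟩ k
  rw [Matrix.sub_apply, Matrix.sub_mul, Matrix.sub_apply, Matrix.one_mul, Matrix.smul_mul,
    Matrix.smul_apply, col, col, col, vv_apply]
  refine Fin.cases ?_ (fun i => ?_) i
  · simp [bshift_zero]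
  · rw [bshift_succ, bshift_succ]
    simp [hank, sShift, Fin.succ_ne_zero]
    rw [show (i : ℕ) + 1 + k.1 = i + k.1 + 1 by omega]; ring

/-- Lemma (ML9-1b): the identities
`H_n^⊐·R_T(α)·(v·v*·H_n·H_{α▷n}^⊐ + T) = H_{α▷n}^⊐` and
`H_{α▷n}^⊐·(I - H_n·v·v*·R_{T*}(α)·H_n^⊐) = T*·R_{T*}(α)·H_n^⊐`. -/
theorem generalized_inverse_link_identities
    (q : ℕ) (hq : 1 ≤ q) (α : ℝ) (n : ℕ) (s : ℕ → Matrix (Fin q) (Fin q) ℂ)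
    (hK : ∃ t : ℕ → Matrix (Fin q) (Fin q) ℂ,
      (∀ j ≤ 2 * n + 1, t j = s j) ∧
        (hank q (n + 1) t).PosSemidef ∧ (hank q n (sShift α t)).PosSemidef)
    (G Gα : Matrix (Fin (n + 1) × Fin q) (Fin (n + 1) × Fin q) ℂ)
    (hG : IsRGI (hank q n s) G (Dsub q n s))
    (hGα : IsRGI (hank q n (sShift α s)) Gα (Dsub q n (sShift α s))) :
    G * RT q n (α : ℂ) * (vq q n * (vq q n)ᴴ * hank q n s * Gα + bshift q n) = Gα ∧
    Gα * (1 - hank q n s * vq q n * (vq q n)ᴴ * RTs q n (α : ℂ) * G) =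
      (bshift q n)ᴴ * RTs q n (α : ℂ) * G := by
  obtain ⟨t, hts, hH1, hK1⟩ := hK
  have hsh : ∀ i ≤ 2 * n, sShift α t i = sShift α s i := by
    intro i hi
    simp only [sShift]
    rw [hts _ (by omega), hts _ (by omega)]
  have hHn : (hank q n s).PosSemidef := by
    rw [← hank_congr (fun i hi => hts i (by omega))]
    exact hank_psd_mono (Nat.le_succ n) hH1
  have hKn : (hank q n (sShift α s)).PosSemidef := by
    rw [← hank_congr hsh]; exact hK1
  have GH := rgi_herm hHn.1 hG
  have GαH := rgi_herm hKn.1 hGα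
  -- kernel chain
  have c1 : ∀ j ≤ n, ∀ x, (LS q s j)ᴴ *ᵥ x = 0 → (LS q (sShift α s) j)ᴴ *ᵥ x = 0 := by
    intro j hj x hx
    rw [← LS_congr (t := t) (fun i hi => hts i (by omega)),
      LS_ker (hank_psd_mono (by omega) hH1)] at hx
    rw [← LS_congr (t := sShift α t) (fun i hi => hsh i (by omega)),
      LS_ker (hank_psd_mono hj hK1)]
    obtain ⟨p, hp, hk⟩ := hx
    exact ⟨p, hp, step1 α (hank_psd_mono (by omega) hH1) hk⟩
  have c2 : ∀ j, j + 1 ≤ n → ∀ x, (LS q (sShift α s) j)ᴴ *ᵥ x = 0 → (LS q s (j + 1))ᴴ *ᵥ x = 0 := by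
    intro j hj x hx
    rw [← LS_congr (t := t) (fun i hi => hts i (by omega)),
      LS_ker (hank_psd_mono (by omega) hH1)]
    rw [← LS_congr (t := sShift α t) (fun i hi => hsh i (by omega)),
      LS_ker (hank_psd_mono (by omega) hK1)] at hx
    obtain ⟨p, rfl, hk⟩ := hx
    exact step2 α (hank_psd_mono hj hK1) hk
  have kG : ∀ x, G *ᵥ x = 0 ↔ ∀ j : Fin (n + 1), (LS q s j.val)ᴴ *ᵥ (fun a => x (j, a)) = 0 :=
    fun x => (hG.2.2.2 x).trans (ldiag_ker q n s x)
  have kGα : ∀ x, Gα *ᵥ x = 0 ↔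
      ∀ j : Fin (n + 1), (LS q (sShift α s) j.val)ᴴ *ᵥ (fun a => x (j, a)) = 0 :=
    fun x => (hGα.2.2.2 x).trans (ldiag_ker q n _ x)
  have hR : (1 - (α : ℂ) • bshift q n) * RT q n α = 1 :=
    mul_nonsing_inv _ ((isUnit_iff_isUnit_det _).1 (shift_unit q n α))
  have hR' : RT q n α * (1 - (α : ℂ) • bshift q n) = 1 :=
    nonsing_inv_mul _ ((isUnit_iff_isUnit_det _).1 (shift_unit q n α))
  have hRs : RTs q n α = (RT q n α)ᴴ := by
    rw [RTs, RT, conjTranspose_nonsing_inv]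
    simp
  obtain ⟨-, hg2, -, -⟩ := hG
  obtain ⟨-, hgα2, -, -⟩ := hGα
  set H := hank q n s with hHdef
  set K := hank q n (sShift α s) with hKdef
  set T := bshift q n with hT
  set R := RT q n α with hRdef
  have HH : Hᴴ = H := hHn.1
  have KH : Kᴴ = K := hKn.1
  have zero_of : ∀ A : Matrix (Fin (n + 1) × Fin q) (Fin (n + 1) × Fin q) ℂ,
      (∀ x, A *ᵥ x = 0) → A = 0 := by
    intro A h
    apply Matrix.ext_of_mulVec_single
    intro i; rw [h, zero_mulVec]
  have e1 : Gα * H * G = Gα := by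
    have : Gα * (1 - H * G) = 0 := by
      apply zero_of
      intro x
      rw [← mulVec_mulVec, kGα]
      intro j
      apply c1 _ (by omega)
      revert j
      rw [← kG, mulVec_mulVec, Matrix.mul_sub, ← Matrix.mul_assoc, hg2]
      simp
    rw [Matrix.mul_sub, ← Matrix.mul_assoc, sub_eq_zero, Matrix.mul_one] at this
    exact this.symm
  have e1' : G * H * Gα = Gα := by
    have := congrArg conjTranspose e1
    simpa [GH, GαH, HH, Matrix.mul_assoc] using this
  have e2 : G * R * T * K * Gα = G * R * T := by
    have : G * (R * T * (1 - K * Gα)) = 0 := by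
      apply zero_of
      intro x
      set w := (1 - K * Gα) *ᵥ x with hw
      have hw0 : Gα *ᵥ w = 0 := by
        rw [hw, mulVec_mulVec, Matrix.mul_sub, ← Matrix.mul_assoc, hgα2]
        simp
      rw [kGα] at hw0
      rw [← mulVec_mulVec, ← mulVec_mulVec, ← hw]
      set y := (R * T) *ᵥ w with hy
      have hyw : y - (α : ℂ) • (T *ᵥ y) = T *ᵥ w := by
        have : (1 - (α : ℂ) • T) *ᵥ y = T *ᵥ w := by
          rw [hy, mulVec_mulVec, ← Matrix.mul_assoc, hR, Matrix.one_mul]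
        rwa [sub_mulVec, one_mulVec, smul_mulVec] at this
      rw [kG]
      intro j
      induction j using Fin.induction with
      | zero =>
        have : (fun a => y (0, a)) = 0 := by
          ext a
          have := congrFun hyw (0, a)
          simpa [hT, bshift_zero] using this
        rw [this, mulVec_zero]
      | succ i ih =>
        have : (fun a => y (i.succ, a)) =
            (α : ℂ) • (fun a => y (i.castSucc, a)) + (fun a => w (i.castSucc, a)) := by
          ext a
          have := congrFun hyw (i.succ, a)
          simp only [hT, Pi.sub_apply, Pi.smul_apply, bshift_succ] at this
          simp only [Pi.add_apply, Pi.smul_apply]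
          rw [← this]; ring
        have i1 := c2 i.val (by omega) _ (c1 i.val (by omega) _ ih)
        have i2 := c2 i.val (by omega) _ (hw0 i.castSucc)
        rw [this, mulVec_add, mulVec_smul, Fin.val_succ, i1, i2]
        simp
    rw [Matrix.mul_sub, Matrix.mul_sub, sub_eq_zero, Matrix.mul_one] at this
    simp only [Matrix.mul_assoc] at this ⊢
    exact this.symm
  have hl : R * (vq q n * (vq q n)ᴴ * H) = H - R * T * K := by
    have := link q n α s
    rw [Matrix.mul_assoc R T K, this, Matrix.mul_sub, ← Matrix.mul_assoc R (1 - _), hR', ← hHdef, Matrix.one_mul]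
    abel
  have first : G * R * (vq q n * (vq q n)ᴴ * H * Gα + T) = Gα := by
    calc _ = G * (R * (vq q n * (vq q n)ᴴ * H)) * Gα + G * R * T := by
          simp only [Matrix.mul_add, Matrix.mul_assoc]
      _ = G * H * Gα - G * R * T * K * Gα + G * R * T := by
          rw [hl]; simp only [Matrix.mul_sub, Matrix.sub_mul, Matrix.mul_assoc]
      _ = Gα := by rw [e1', e2]; abel
  refine ⟨first, ?_⟩
  have := congrArg conjTranspose first
  simp only [conjTranspose_mul, conjTranspose_add, conjTranspose_conjTranspose, GH, GαH, HH] at this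
  rw [hRs, Matrix.mul_sub, Matrix.mul_one]
  nth_rewrite 1 [← this]
  simp only [Matrix.add_mul, Matrix.mul_assoc]
  abel
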